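/- Strong Minimum Principle: assume F satisfies (F1) and (F2B) with constants 0 < λ ≤ Λ and φ satisfying the Osgood condition (φ_A). Let Ω ⊆ ℝⁿ be an open connected set and let v be a lower semicontinuous viscosity supersolution of F(x,u,Du,D²u) = 0 in Ω. If there exists x₀ ∈ Ω with v(x₀) < 0 and v(x₀) ≤ v(x) for all x ∈ Ω (v attains a negative minimum in Ω), then v is constant on Ω. -/

import Mathlib

open Metric Set Filter MeasureTheory
open scoped Topology RealInnerProductSpace Classical

noncomputable section

/-- Euclidean space `ℝⁿ`. -/
abbrev Eucl (n : ℕ) := EuclideanSpace ℝ (Fin n)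

/-- Real `n × n` matrices. -/
abbrev Mat (n : ℕ) := Matrix (Fin n) (Fin n) ℝ

variable {n : ℕ}

/-- Eigenvalues of a matrix (junk value `0` if the matrix is not symmetric). -/
noncomputable def eigenvals (X : Mat n) : Fin n → ℝ :=
  if h : X.IsHermitian then h.eigenvalues else 0

/-- The Pucci maximal operator `P⁺_{λ,Λ}(X) = -λ Σ_{eᵢ ≥ 0} eᵢ - Λ Σ_{eᵢ < 0} eᵢ`. -/
noncomputable def pucciPlus (lam Lam : ℝ) (X : Mat n) : ℝ :=
  ∑ i, (if 0 ≤ eigenvals X i then -(lam * eigenvals X i) else -(Lam * eigenvals X i))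

/-- The Pucci minimal operator `P⁻_{λ,Λ}(X) = -Λ Σ_{eᵢ ≥ 0} eᵢ - λ Σ_{eᵢ < 0} eᵢ`. -/
noncomputable def pucciMinus (lam Lam : ℝ) (X : Mat n) : ℝ :=
  ∑ i, (if 0 ≤ eigenvals X i then -(Lam * eigenvals X i) else -(lam * eigenvals X i))

/-- The positive semidefinite order `X ≤ Y` on symmetric matrices. -/
def matLE (X Y : Mat n) : Prop := (Y - X).PosSemidef

/-- Structure condition (F1): `F(x,u,p,X) ≥ F(x,v,p,Y)` whenever `u ≥ v` and `X ≤ Y`. -/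
def CondF1 (F : Eucl n → ℝ → Eucl n → Mat n → ℝ) : Prop :=
  ∀ x u v p X Y, v ≤ u → matLE X Y → F x v p Y ≤ F x u p X

/-- Structure condition (F2A): `-F(x,0,p,X) ≤ φ(|p|) - P⁻_{λ,Λ}(X)`. -/
def CondF2A (lam Lam : ℝ) (φ : ℝ → ℝ) (F : Eucl n → ℝ → Eucl n → Mat n → ℝ) : Prop :=
  ∀ x p X, X.IsHermitian → -F x 0 p X ≤ φ ‖p‖ - pucciMinus lam Lam X

/-- Structure condition (F2B): `F(x,0,p,X) ≤ φ(|p|) + P⁺_{λ,Λ}(X)`. -/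
def CondF2B (lam Lam : ℝ) (φ : ℝ → ℝ) (F : Eucl n → ℝ → Eucl n → Mat n → ℝ) : Prop :=
  ∀ x p X, X.IsHermitian → F x 0 p X ≤ φ ‖p‖ + pucciPlus lam Lam X

/-- Structure condition (F2B*): `F(x,r,p,X) ≤ φ(|p|) + P⁺_{λ,Λ}(X) + γ(r)` for `r > 0`. -/
def CondF2Bstar (lam Lam : ℝ) (φ γF : ℝ → ℝ) (F : Eucl n → ℝ → Eucl n → Mat n → ℝ) : Prop :=
  ∀ x (r : ℝ) p X, 0 < r → X.IsHermitian →
    F x r p X ≤ φ ‖p‖ + pucciPlus lam Lam X + γF r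

/-- `γ` is nonnegative and dominated by `φ`: `γ(r) ≤ C* φ(r)` whenever `0 < r ≤ 1`. -/
def GammaDominated (Cstar : ℝ) (φ γF : ℝ → ℝ) : Prop :=
  (∀ r : ℝ, 0 < r → 0 ≤ γF r) ∧ ∀ r : ℝ, 0 < r → r ≤ 1 → γF r ≤ Cstar * φ r

/-- Standing assumptions on `φ : [0,∞) → [0,∞)`: continuous, strictly increasing and
`φ(t) ≥ t`. -/
def PhiAdmissible (φ : ℝ → ℝ) : Prop :=
  ContinuousOn φ (Ici 0) ∧ StrictMonoOn φ (Ici 0) ∧ ∀ t : ℝ, 0 ≤ t → t ≤ φ t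

/-- The Osgood condition (φ_A): `∫₀¹ dt / φ(t) = ∞`, as divergence of the improper
Riemann integral. -/
def OsgoodCondition (φ : ℝ → ℝ) : Prop :=
  Tendsto (fun ε : ℝ => ∫ t in ε..1, 1 / φ t) (𝓝[>] 0) atTop

/-- Condition (φ_B): for every sufficiently small `ε > 0`, `∫₀^ε f_ν(t) dt → ∞` as `ν → ∞`,
where `f_ν` solves `f' = -φ(f)`, `f(0) = ν`. -/
def CondPhiB (φ : ℝ → ℝ) : Prop :=
  ∃ ε₀ > (0:ℝ), ∀ ε : ℝ, 0 < ε → ε ≤ ε₀ → ∀ M : ℝ, 0 < M → ∃ ν₀ > (0:ℝ), ∀ ν : ℝ, ν₀ ≤ ν →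
    ∀ f : ℝ → ℝ, (∀ t ∈ Icc (0:ℝ) ε, 0 ≤ f t) → f 0 = ν →
      (∀ t ∈ Icc (0:ℝ) ε, HasDerivAt f (-φ (f t)) t) →
      M ≤ ∫ t in (0:ℝ)..ε, f t

/-- The Hessian matrix of a real valued function on Euclidean space. -/
noncomputable def hess (ψ : Eucl n → ℝ) (x : Eucl n) : Mat n :=
  Matrix.of fun i j =>
    iteratedFDeriv ℝ 2 ψ x ![EuclideanSpace.single i 1, EuclideanSpace.single j 1]

/-- Viscosity subsolution of `F(x,u,Du,D²u) = 0` in the open set `Ω`. -/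
def ViscositySubsolution (F : Eucl n → ℝ → Eucl n → Mat n → ℝ) (Ω : Set (Eucl n))
    (u : Eucl n → ℝ) : Prop :=
  ∀ ψ : Eucl n → ℝ, ContDiffOn ℝ 2 ψ Ω → ∀ x₀ ∈ Ω,
    IsLocalMaxOn (fun x => u x - ψ x) Ω x₀ →
    F x₀ (u x₀) (gradient ψ x₀) (hess ψ x₀) ≤ 0

/-- Viscosity supersolution of `F(x,u,Du,D²u) = 0` in the open set `Ω`. -/
def ViscositySupersolution (F : Eucl n → ℝ → Eucl n → Mat n → ℝ) (Ω : Set (Eucl n))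
    (v : Eucl n → ℝ) : Prop :=
  ∀ ψ : Eucl n → ℝ, ContDiffOn ℝ 2 ψ Ω → ∀ x₀ ∈ Ω,
    IsLocalMinOn (fun x => v x - ψ x) Ω x₀ →
    0 ≤ F x₀ (v x₀) (gradient ψ x₀) (hess ψ x₀)

/-- Strict classical (twice differentiable) subsolution on an open set. -/
def StrictClassicalSubsolution (F : Eucl n → ℝ → Eucl n → Mat n → ℝ) (Ω : Set (Eucl n))
    (u : Eucl n → ℝ) : Prop :=
  ContDiffOn ℝ 2 u Ω ∧ ∀ x ∈ Ω, F x (u x) (gradient u x) (hess u x) < 0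

/-- Strict classical (twice differentiable) supersolution on an open set. -/
def StrictClassicalSupersolution (F : Eucl n → ℝ → Eucl n → Mat n → ℝ) (Ω : Set (Eucl n))
    (v : Eucl n → ℝ) : Prop :=
  ContDiffOn ℝ 2 v Ω ∧ ∀ x ∈ Ω, 0 < F x (v x) (gradient v x) (hess v x)

/-- The interior ball condition at a boundary point `w` with radius `ri`. -/
def InteriorBallAt (Ω : Set (Eucl n)) (w : Eucl n) (ri : ℝ) : Prop :=
  ∃ y, ball y ri ⊆ Ω ∧ sphere y ri ∩ frontier Ω = {w}

/-- The interior ball condition (for all boundary points). -/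
def InteriorBallCondition (Ω : Set (Eucl n)) (ri : ℝ) : Prop :=
  ∀ w ∈ frontier Ω, InteriorBallAt Ω w ri

/-- The exterior ball condition at a boundary point `w` with radius `re`. -/
def ExteriorBallAt (Ω : Set (Eucl n)) (w : Eucl n) (re : ℝ) : Prop :=
  ∃ y, ball y re ⊆ Ωᶜ ∧ sphere y re ∩ frontier Ω = {w}

/-- The exterior ball condition (for all boundary points). -/
def ExteriorBallCondition (Ω : Set (Eucl n)) (re : ℝ) : Prop :=
  ∀ w ∈ frontier Ω, ExteriorBallAt Ω w re

/-- The ball condition: both the interior and the exterior ball condition. -/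
def BallCondition (Ω : Set (Eucl n)) (rb : ℝ) : Prop :=
  InteriorBallCondition Ω rb ∧ ExteriorBallCondition Ω rb

/-- The annulus `B(y,R) ∖ closure B(y,r)`. -/
def annulus (y : Eucl n) (r R : ℝ) : Set (Eucl n) := ball y R \ closedBall y r

/-- Under the Osgood condition, `f' = -K φ(f)` has arbitrarily small solutions that stay positive. -/
theorem OsgoodCondition.exists_pos_solution {φ : ℝ → ℝ} (hφ : PhiAdmissible φ)
    (hOsg : OsgoodCondition φ) {K ε a : ℝ} (hK : 0 < K) (hε : 0 < ε) :
    ∃ f f' : ℝ → ℝ, (∀ s, HasDerivAt f (f' s) s) ∧ Continuous f' ∧ (∀ s, 0 < f s) ∧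
      ∀ s, a ≤ s → f s < ε ∧ f' s = -(K * φ (f s)) := by
  obtain ⟨hcont, -, hle⟩ := hφ
  -- truncate `φ` at height `1` so that the inverse of the time map is defined on all of `ℝ`
  set q : ℝ → ℝ := fun t => φ (min |t| 1) with hq
  have hqc : Continuous q :=
    hcont.comp_continuous (by fun_prop) fun t => le_min (abs_nonneg t) zero_le_one
  have hqpos : ∀ t, 0 < t → 0 < q t := fun t ht =>
    (lt_min (abs_pos.2 ht.ne') one_pos).trans_le (hle _ (le_min (abs_nonneg t) zero_le_one))
  have hqeq : ∀ t, 0 < t → t ≤ 1 → q t = φ t := fun t h0 h1 => by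
    simp [hq, abs_of_pos h0, h1]
  have hqcont : ∀ s, 0 < s → ContinuousOn (fun t => 1 / q t) (uIcc 1 s) := fun s hs => by
    refine continuousOn_const.div hqc.continuousOn fun t ht => (hqpos t ?_).ne'
    exact (lt_min one_pos hs).trans_le ht.1
  set S : ℝ → ℝ := fun τ => ∫ t in (1 : ℝ)..Real.exp τ, 1 / q t with hS
  have hSd : ∀ τ, HasDerivAt S (1 / q (Real.exp τ) * Real.exp τ) τ := fun τ => by
    have h := intervalIntegral.integral_hasDerivAt_right
      (hqcont _ (Real.exp_pos τ)).intervalIntegrable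
      (Measurable.stronglyMeasurable (by
        have := hqc.measurable
        fun_prop)).stronglyMeasurableAtFilter
      (continuousAt_const.div hqc.continuousAt (hqpos _ (Real.exp_pos τ)).ne')
    exact HasDerivAt.comp τ h (Real.hasDerivAt_exp τ)
  have hSd_pos : ∀ τ, 0 < 1 / q (Real.exp τ) * Real.exp τ := fun τ =>
    mul_pos (one_div_pos.2 (hqpos _ (Real.exp_pos τ))) (Real.exp_pos τ)
  have hSmono : StrictMono S := strictMono_of_hasDerivAt_pos hSd hSd_pos
  have hScont : Continuous S := continuous_iff_continuousAt.2 fun τ => (hSd τ).continuousAt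
  have hStop : Tendsto S atTop atTop := by
    have h1 : Tendsto (fun τ => (Real.exp τ - 1) * (1 / φ 1)) atTop atTop :=
      ((tendsto_atTop_add_const_right _ (-1) Real.tendsto_exp_atTop)).atTop_mul_const
        (one_div_pos.2 (one_pos.trans_le (hle 1 zero_le_one)))
    refine tendsto_atTop_mono' _ ?_ h1
    filter_upwards [eventually_ge_atTop 0] with τ hτ
    have h2 : ∀ t ∈ uIcc 1 (Real.exp τ), 1 / q t = 1 / φ 1 := fun t ht => by
      rw [uIcc_of_le (Real.one_le_exp hτ)] at ht
      have : (1 : ℝ) ≤ |t| := ht.1.trans (le_abs_self t)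
      simp [hq, min_eq_right this]
    simp only [hS]
    rw [intervalIntegral.integral_congr h2, intervalIntegral.integral_const, smul_eq_mul]
  have hSbot : Tendsto S atBot atBot := by
    have h1 : Tendsto Real.exp atBot (𝓝[>] 0) := Real.tendsto_exp_atBot_nhdsGT
    refine (tendsto_neg_atTop_atBot.comp (hOsg.comp h1)).congr' ?_
    filter_upwards [eventually_le_atBot 0] with τ hτ
    have hτ1 : Real.exp τ ≤ 1 := Real.exp_le_one_iff.2 hτ
    simp only [hS, Function.comp]
    have h2 : ∀ t ∈ uIcc (Real.exp τ) 1, 1 / φ t = 1 / q t := fun t ht => by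
      rw [uIcc_of_le hτ1] at ht
      rw [hqeq t ((Real.exp_pos τ).trans_le ht.1) ht.2]
    rw [intervalIntegral.integral_congr h2, ← intervalIntegral.integral_symm]
  set e : ℝ ≃o ℝ := hSmono.orderIsoOfSurjective S (hScont.surjective hStop hSbot) with he
  have hes : ∀ s, S (e.symm s) = s := fun s => e.apply_symm_apply s
  have hed : ∀ s, HasDerivAt e.symm (1 / q (Real.exp (e.symm s)) * Real.exp (e.symm s))⁻¹ s :=
    fun s => (hSd _).of_local_left_inverse e.symm.continuous.continuousAt (hSd_pos _).ne'
      (Eventually.of_forall hes)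
  set c := min (ε / 2) 1 with hc
  have hc0 : 0 < c := lt_min (half_pos hε) one_pos
  set θ : ℝ → ℝ := fun s => e.symm (S (Real.log c) - K * (s - a)) with hθ
  have hθc : Continuous θ := e.symm.continuous.comp (by fun_prop)
  refine ⟨fun s => Real.exp (θ s), fun s => -(K * q (Real.exp (θ s))), fun s => ?_, by fun_prop,
    fun s => Real.exp_pos _, fun s hs => ?_⟩
  · have h1 : HasDerivAt (fun s => S (Real.log c) - K * (s - a)) (-(K * 1)) s :=
      (((hasDerivAt_id s).sub_const a).const_mul K).const_sub _
    have h2 := (hqpos _ (Real.exp_pos (θ s))).ne'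
    have h3 := (Real.exp_pos (θ s)).ne'
    refine (((hed _).comp s h1).exp).congr_deriv ?_
    change Real.exp (θ s) * ((1 / q (Real.exp (θ s)) * Real.exp (θ s))⁻¹ * -(K * 1)) = _
    field_simp
  · have h1 : θ s ≤ Real.log c := by
      rw [hθ, ← hSmono.le_iff_le, hes]
      nlinarith [mul_nonneg hK.le (sub_nonneg.2 hs)]
    have h2 : Real.exp (θ s) ≤ c := by
      rwa [← Real.le_log_iff_exp_le hc0]
    refine ⟨(h2.trans (min_le_left _ _)).trans_lt (half_lt_self hε), ?_⟩
    simp only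
    rw [hqeq _ (Real.exp_pos _) (h2.trans (min_le_right _ _))]

theorem eigenvals_eq {X : Mat n} (hX : X.IsHermitian) : eigenvals X = hX.eigenvalues :=
  dif_pos hX

theorem pucciPlus_le_of_neg_le_eigenvals {lam Lam a : ℝ} (ha : 0 ≤ a)
    (hlam : lam ≤ Lam) {X : Mat n} (hX : X.IsHermitian) (h : ∀ i, -a ≤ eigenvals X i) :
    pucciPlus lam Lam X ≤ (Lam - lam) * n * a - lam * X.trace := by
  have htr : X.trace = ∑ i, eigenvals X i := by
    rw [eigenvals_eq hX]
    simpa using hX.trace_eq_sum_eigenvalues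
  rw [htr, Finset.mul_sum]
  have : (Lam - lam) * n * a = ∑ _i : Fin n, (Lam - lam) * a := by
    simp; ring
  rw [this, ← Finset.sum_sub_distrib]
  refine Finset.sum_le_sum fun i _ => ?_
  split_ifs
  · nlinarith [mul_nonneg (sub_nonneg.2 hlam) ha]
  · nlinarith [mul_nonneg (sub_nonneg.2 hlam) (by linarith [h i] : 0 ≤ a + eigenvals X i)]

open scoped Matrix in
/-- A rank-one perturbation of a nonpositive multiple of the identity. -/
theorem pucciPlus_neg_one_add_vecMulVec_le {lam Lam a b : ℝ} (hlam : lam ≤ Lam) (ha : 0 ≤ a)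
    (hb : 0 ≤ b) (d : Fin n → ℝ) :
    (-a • (1 : Mat n) + b • Matrix.vecMulVec d d).IsHermitian ∧
    pucciPlus lam Lam (-a • (1 : Mat n) + b • Matrix.vecMulVec d d) ≤
      Lam * n * a - lam * (b * (d ⬝ᵥ d)) := by
  set X := -a • (1 : Mat n) + b • Matrix.vecMulVec d d with hXdef
  have hX : X.IsHermitian := by
    ext i j
    simp [hXdef, Matrix.vecMulVec_apply, Matrix.one_apply, eq_comm, mul_comm (d i)]
  refine ⟨hX, ?_⟩
  have hev : ∀ i, -a ≤ eigenvals X i := fun i => by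
    rw [eigenvals_eq hX]
    set u : Fin n → ℝ := (hX.eigenvectorBasis i).ofLp
    have h1 : X *ᵥ u = hX.eigenvalues i • u := hX.mulVec_eigenvectorBasis i
    have h2 : X *ᵥ u = -a • u + (b * (d ⬝ᵥ u)) • d := by
      rw [hXdef, Matrix.add_mulVec, Matrix.smul_mulVec, Matrix.smul_mulVec, Matrix.one_mulVec,
        Matrix.vecMulVec_mulVec]
      ext j
      simp
      ring
    have h3 : u ⬝ᵥ u = 1 := by
      have := hX.eigenvectorBasis.orthonormal.1 i
      rw [EuclideanSpace.norm_eq, Real.sqrt_eq_one] at this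
      simpa [dotProduct, sq] using this
    have h4 := congrArg (fun w => u ⬝ᵥ w) (h1.symm.trans h2)
    simp only [dotProduct_smul, dotProduct_add, h3, smul_eq_mul, dotProduct_comm u d] at h4
    nlinarith [mul_nonneg hb (mul_self_nonneg (d ⬝ᵥ u))]
  refine (pucciPlus_le_of_neg_le_eigenvals ha hlam hX hev).trans_eq ?_
  simp [hXdef, Matrix.trace_add, Matrix.trace_smul, Matrix.trace_vecMulVec]
  ring

section Radial

variable {G g₁ g₂ : ℝ → ℝ}

theorem hasFDerivAt_norm_sub_sq (y x : Eucl n) :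
    HasFDerivAt (fun x : Eucl n => ‖x - y‖ ^ 2) ((2 : ℝ) • innerSL ℝ (x - y)) x := by
  refine ((hasFDerivAt_id x).sub_const y).norm_sq.congr_fderiv ?_
  ext z
  simp

theorem hasFDerivAt_radial (hG : ∀ s, HasDerivAt G (g₁ s) s) (y x : Eucl n) :
    HasFDerivAt (fun x : Eucl n => G (‖x - y‖ ^ 2))
      ((2 * g₁ (‖x - y‖ ^ 2)) • innerSL ℝ (x - y)) x := by
  refine ((hG _).comp_hasFDerivAt x (hasFDerivAt_norm_sub_sq y x)).congr_fderiv ?_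
  rw [smul_smul, mul_comm]

theorem gradient_radial (hG : ∀ s, HasDerivAt G (g₁ s) s) (y x : Eucl n) :
    gradient (fun x : Eucl n => G (‖x - y‖ ^ 2)) x = (2 * g₁ (‖x - y‖ ^ 2)) • (x - y) := by
  apply HasGradientAt.gradient
  rw [hasGradientAt_iff_hasFDerivAt]
  refine (hasFDerivAt_radial hG y x).congr_fderiv ?_
  ext z
  simp

theorem hess_radial (hG : ∀ s, HasDerivAt G (g₁ s) s) (hg : ∀ s, HasDerivAt g₁ (g₂ s) s)
    (y x : Eucl n) :
    hess (fun x : Eucl n => G (‖x - y‖ ^ 2)) x =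
      (2 * g₁ (‖x - y‖ ^ 2)) • (1 : Mat n) +
        (4 * g₂ (‖x - y‖ ^ 2)) • Matrix.vecMulVec (x - y).ofLp (x - y).ofLp := by
  let L : Eucl n →L[ℝ] Eucl n →L[ℝ] ℝ := innerSL ℝ
  have hL : ∀ a b, L a b = inner ℝ a b := fun _ _ => rfl
  have h1 : fderiv ℝ (fun x : Eucl n => G (‖x - y‖ ^ 2)) =
      fun x => (2 * g₁ (‖x - y‖ ^ 2)) • L (x - y) :=
    funext fun x => (hasFDerivAt_radial hG y x).fderiv
  have h2 : HasFDerivAt (fun x => (2 * g₁ (‖x - y‖ ^ 2)) • L (x - y))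
      ((2 * g₁ (‖x - y‖ ^ 2)) • L +
        ((4 * g₂ (‖x - y‖ ^ 2)) • L (x - y)).smulRight (L (x - y))) x := by
    refine (((hasFDerivAt_radial hg y x).const_mul 2).smul
      (L.hasFDerivAt.comp x ((hasFDerivAt_id x).sub_const y))).congr_fderiv ?_
    change _ • (L.comp (ContinuousLinearMap.id ℝ _)) +
      ((2 : ℝ) • (2 * g₂ _) • L (x - y)).smulRight (L (x - y)) = _
    rw [ContinuousLinearMap.comp_id, smul_smul, ← mul_assoc]
    norm_num
  ext i j
  rw [hess, Matrix.of_apply, iteratedFDeriv_two_apply, h1, h2.fderiv]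
  simp [hL, Matrix.one_apply, Matrix.vecMulVec_apply, EuclideanSpace.inner_single_right,
    eq_comm (a := j), mul_assoc]

theorem contDiff_radial (hG : ∀ s, HasDerivAt G (g₁ s) s) (hg : ∀ s, HasDerivAt g₁ (g₂ s) s)
    (hc : Continuous g₂) (y : Eucl n) :
    ContDiff ℝ 2 (fun x : Eucl n => G (‖x - y‖ ^ 2)) := by
  have h1 : ContDiff ℝ 1 g₁ := contDiff_one_iff_deriv.2
    ⟨fun s => (hg s).differentiableAt, by rwa [funext fun s => (hg s).deriv]⟩
  have h2 : ContDiff ℝ (1 + 1) G := contDiff_succ_iff_deriv.2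
    ⟨fun s => (hG s).differentiableAt, by simp, by rwa [funext fun s => (hG s).deriv]⟩
  rw [one_add_one_eq_two] at h2
  exact h2.comp ((contDiff_id.sub contDiff_const).norm_sq ℝ)

end Radial

/-- Hopf-type comparison: a negative minimum is not attained on a sphere whose interior contains no
minimum point. -/
theorem ViscositySupersolution.ne_min_of_mem_sphere
    {lam Lam : ℝ} (hlam : 0 < lam) (hlamLam : lam ≤ Lam)
    {φ : ℝ → ℝ} (hφ : PhiAdmissible φ) (hOsg : OsgoodCondition φ)
    {F : Eucl n → ℝ → Eucl n → Mat n → ℝ} (hF1 : CondF1 F) (hF2B : CondF2B lam Lam φ F)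
    {Ω : Set (Eucl n)} {v : Eucl n → ℝ} (hlsc : LowerSemicontinuousOn v Ω)
    (hsuper : ViscositySupersolution F Ω v) {m : ℝ} (hneg : m < 0) (hmin : ∀ x ∈ Ω, m ≤ v x)
    {y z : Eucl n} {R : ℝ} (hR : 0 < R) (hball : closedBall y (2 * R) ⊆ Ω)
    (hlt : ∀ x ∈ ball y R, v x ≠ m) (hz : dist z y = R) : v z ≠ m := by
  intro hvz
  have hLam : 0 < Lam := hlam.trans_le hlamLam
  obtain ⟨x₂, hx₂, hx₂min⟩ := (hlsc.mono ((closedBall_subset_closedBall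
    (by linarith)).trans hball)).exists_isMinOn (s := closedBall y (R / 2))
    ⟨y, mem_closedBall_self (by positivity)⟩ (isCompact_closedBall _ _)
  have hδ : 0 < v x₂ - m := sub_pos.2 <| lt_of_le_of_ne
    (hmin _ (hball (closedBall_subset_closedBall (by linarith) hx₂)))
    (hlt _ (closedBall_subset_ball (by linarith) hx₂)).symm
  set η := min (v x₂ - m) (-m) with hηdef
  have hη : 0 < η := lt_min hδ (neg_pos.2 hneg)
  have hη₁ : η ≤ v x₂ - m := min_le_left _ _
  have hη₂ : η ≤ -m := min_le_right _ _
  set K := (2 + Lam * n / (2 * R)) * 4 / (lam * R) with hKdef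
  have hK : 0 < K := by positivity
  obtain ⟨f, f', hf, hf'c, hfpos, hfa⟩ :=
    hOsg.exists_pos_solution hφ (a := R ^ 2 / 4) hK (div_pos hη hR)
  have hfc : Continuous f := continuous_iff_continuousAt.2 fun s => (hf s).continuousAt
  set g₁ : ℝ → ℝ := fun s => -f s / (4 * R) with hg₁
  set g₂ : ℝ → ℝ := fun s => -f' s / (4 * R) with hg₂
  set G : ℝ → ℝ := fun s => m + ∫ t in (R ^ 2)..s, g₁ t with hGdef
  have hg : ∀ s, HasDerivAt g₁ (g₂ s) s := fun s => (hf s).neg.div_const _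
  have hg₁c : Continuous g₁ := by fun_prop
  have hG : ∀ s, HasDerivAt G (g₁ s) s := fun s =>
    (intervalIntegral.integral_hasDerivAt_right (hg₁c.intervalIntegrable _ _)
      hg₁c.stronglyMeasurable.stronglyMeasurableAtFilter hg₁c.continuousAt).const_add m
  have hGR : G (R ^ 2) = m := by simp [hGdef]
  have hGanti : StrictAnti G := strictAnti_of_hasDerivAt_neg hG fun s =>
    div_neg_of_neg_of_pos (neg_neg_of_pos (hfpos s)) (by positivity)
  have hGc : Continuous G := continuous_iff_continuousAt.2 fun s => (hG s).continuousAt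
  have hGle : ∀ s, R ^ 2 / 4 ≤ s → G s ≤ m + η / 4 := by
    intro s hs
    refine (hGanti.antitone hs).trans ?_
    have h := (convex_Ici (R ^ 2 / 4)).mul_sub_le_image_sub_of_le_deriv (f := G)
      (C := -(η / R) / (4 * R)) hGc.continuousOn
      (fun x _ => (hG x).differentiableAt.differentiableWithinAt)
      (fun x hx => by
        rw [(hG x).deriv]
        have := (hfa x (interior_subset hx)).1
        simp only [hg₁]
        gcongr) _ self_mem_Ici (R ^ 2) (by rw [mem_Ici]; nlinarith) (by nlinarith)
    rw [hGR] at h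
    have h2 : -(η / R) / (4 * R) * (R ^ 2 - R ^ 2 / 4) = -(3 / 16 * η) := by
      field_simp
      ring
    linarith
  set w : Eucl n → ℝ := fun x => G (‖x - y‖ ^ 2) with hw
  have hwc : ContDiff ℝ 2 w := contDiff_radial hG hg (hf'c.neg.div_const _) y
  set A : Set (Eucl n) := closedBall y (2 * R) ∩ {x | R / 2 ≤ dist x y} with hA
  have hAc : IsCompact A := (isCompact_closedBall _ _).inter_right
    (isClosed_le continuous_const (by fun_prop))
  have hzA : z ∈ A := ⟨by rw [mem_closedBall, hz]; linarith, by
    change R / 2 ≤ dist z y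
    rw [hz]; linarith⟩
  have hdiff : LowerSemicontinuousOn (fun x => v x - w x) A := by
    simp only [sub_eq_add_neg]
    exact (hlsc.mono (inter_subset_left.trans hball)).add
      (hwc.continuous.neg.lowerSemicontinuous.lowerSemicontinuousOn _)
  obtain ⟨x₁, hx₁, hx₁min⟩ := hdiff.exists_isMinOn ⟨z, hzA⟩ hAc
  have hx₁Ω : x₁ ∈ Ω := hball hx₁.1
  have hvw : v x₁ ≤ w x₁ := by
    have h : v x₁ - w x₁ ≤ v z - w z := hx₁min hzA
    have : w z = m := by rw [hw]; simp only; rw [← dist_eq_norm, hz, hGR]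
    linarith
  have hmv := hmin x₁ hx₁Ω
  have hupper : dist x₁ y < 2 * R := by
    refine lt_of_le_of_ne hx₁.1 fun h => ?_
    have : w x₁ < m := by
      rw [← hGR, hw]
      refine hGanti ?_
      rw [← dist_eq_norm, h]
      nlinarith
    linarith
  have hs : R ^ 2 / 4 ≤ ‖x₁ - y‖ ^ 2 := by
    have : R / 2 ≤ ‖x₁ - y‖ := by rw [← dist_eq_norm]; exact hx₁.2
    nlinarith
  have hwle : w x₁ ≤ m + η / 4 := hGle _ hs
  have hlower : R / 2 < dist x₁ y := by
    refine lt_of_le_of_ne hx₁.2 fun h => ?_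
    have : v x₂ ≤ v x₁ := hx₂min (mem_closedBall.2 h.ge)
    linarith
  have hloc : IsLocalMinOn (fun x => v x - w x) Ω x₁ := by
    have h1 : ∀ᶠ x in 𝓝 x₁, dist x y < 2 * R ∧ R / 2 < dist x y :=
      ((by fun_prop : Continuous fun x => dist x y).continuousAt.eventually_lt_const hupper).and
        ((by fun_prop : Continuous fun x => dist x y).continuousAt.eventually_const_lt hlower)
    filter_upwards [h1.filter_mono nhdsWithin_le_nhds] with x hx
    exact hx₁min ⟨hx.1.le, hx.2.le⟩
  have hF0 := hsuper w hwc.contDiffOn x₁ hx₁Ω hloc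
  rw [hw, gradient_radial hG, hess_radial hG hg] at hF0
  obtain ⟨hfle, hfeq⟩ := hfa _ hs
  set d := x₁ - y with hd
  set s := ‖d‖ ^ 2 with hsdef
  have hfs := hfpos s
  have hφf : f s ≤ φ (f s) := hφ.2.2 _ hfs.le
  have hg₁s : 2 * g₁ s = -(f s / (2 * R)) := by
    simp only [hg₁]; field_simp; ring
  have hg₂s : 4 * g₂ s = K * φ (f s) / R := by
    simp only [hg₂, hfeq]; field_simp
  rw [hg₁s, hg₂s] at hF0
  obtain ⟨hherm, hpucci⟩ := pucciPlus_neg_one_add_vecMulVec_le (lam := lam) (Lam := Lam)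
    (a := f s / (2 * R)) (b := K * φ (f s) / R) hlamLam (by positivity)
    (div_nonneg (mul_nonneg hK.le (hfs.le.trans hφf)) hR.le) d.ofLp
  have hdd : dotProduct d.ofLp d.ofLp = s := by
    rw [hsdef, EuclideanSpace.real_norm_sq_eq]
    simp [dotProduct, sq]
  rw [hdd] at hpucci
  have hmono := hF1 x₁ 0 (v x₁) (-(f s / (2 * R)) • d) _ _ (by linarith)
    (by rw [matLE, sub_self]; exact Matrix.PosSemidef.zero :
      matLE (-(f s / (2 * R)) • (1 : Mat n) + (K * φ (f s) / R) • Matrix.vecMulVec d.ofLp d.ofLp) _)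
  have hbound := hF2B x₁ (-(f s / (2 * R)) • d) _ hherm
  have hgrad : φ ‖-(f s / (2 * R)) • d‖ ≤ φ (f s) := by
    refine hφ.2.1.monotoneOn (norm_nonneg _) hfs.le ?_
    rw [norm_smul, norm_neg, Real.norm_of_nonneg (by positivity), div_mul_eq_mul_div,
      div_le_iff₀ (by positivity)]
    rw [dist_eq_norm] at hupper
    exact mul_le_mul_of_nonneg_left hupper.le hfs.le
  have hfirst : Lam * n * (f s / (2 * R)) ≤ Lam * n / (2 * R) * φ (f s) := by
    calc _ = Lam * n / (2 * R) * f s := by ring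
      _ ≤ _ := by gcongr
  have hsecond : (2 + Lam * n / (2 * R)) * φ (f s) ≤ lam * (K * φ (f s) / R * s) := by
    have hφ0 : 0 ≤ φ (f s) := hfs.le.trans hφf
    calc _ = lam * (K * φ (f s) / R * (R ^ 2 / 4)) := by
          rw [hKdef]; field_simp
      _ ≤ _ := by gcongr
  linarith

theorem ViscositySupersolution.eq_min_of_mem_ball
    {lam Lam : ℝ} (hlam : 0 < lam) (hlamLam : lam ≤ Lam)
    {φ : ℝ → ℝ} (hφ : PhiAdmissible φ) (hOsg : OsgoodCondition φ)
    {F : Eucl n → ℝ → Eucl n → Mat n → ℝ} (hF1 : CondF1 F) (hF2B : CondF2B lam Lam φ F)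
    {Ω : Set (Eucl n)} {v : Eucl n → ℝ} (hlsc : LowerSemicontinuousOn v Ω)
    (hsuper : ViscositySupersolution F Ω v) {m : ℝ} (hneg : m < 0) (hmin : ∀ x ∈ Ω, m ≤ v x)
    {z₀ : Eucl n} {r : ℝ} (hball : closedBall z₀ (4 * r) ⊆ Ω) (hz₀ : v z₀ = m)
    {y : Eucl n} (hy : y ∈ ball z₀ r) : v y = m := by
  by_contra hvy
  have hr : 0 < r := pos_of_mem_ball hy
  have hyr : dist y z₀ < r := hy
  have hz₀B : z₀ ∈ closedBall z₀ (4 * r) := mem_closedBall_self (by positivity)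
  set N := closedBall z₀ (4 * r) ∩ v ⁻¹' Iic m with hN
  have hNc : IsCompact N := (hlsc.mono hball).isCompact_inter_preimage_Iic
    (isCompact_closedBall _ _) m
  obtain ⟨z, hzN, hz⟩ := hNc.exists_infDist_eq_dist ⟨z₀, hz₀B, hz₀.le⟩ y
  have hz₀N : z₀ ∈ N := ⟨hz₀B, hz₀.le⟩
  have hzr : dist y z < r := hz.symm.trans_lt ((infDist_le_dist_of_mem hz₀N).trans_lt hyr)
  have hvz : v z = m := le_antisymm hzN.2 (hmin z (hball hzN.1))
  refine hsuper.ne_min_of_mem_sphere hlam hlamLam hφ hOsg hF1 hF2B hlsc hneg hmin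
    (y := y) (z := z) (R := dist y z) (dist_pos.2 fun h => hvy (h ▸ hvz)) ?_ ?_ (dist_comm z y) hvz
  · exact (closedBall_subset_closedBall' (by linarith)).trans hball
  · intro x hx hvx
    have hx' : dist x y < dist y z := hx
    have hxN : x ∈ N := ⟨by
      rw [mem_closedBall]
      linarith [dist_triangle x y z₀], hvx.le⟩
    have := infDist_le_dist_of_mem (x := y) hxN
    rw [hz, dist_comm y x] at this
    linarith

/-- Remark 4.4, second part: the Strong Minimum Principle. -/
theorem strong_minimum_principle
    {n : ℕ} (lam Lam : ℝ) (hlam : 0 < lam) (hlamLam : lam ≤ Lam)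
    (φ : ℝ → ℝ) (hφ : PhiAdmissible φ) (hOsg : OsgoodCondition φ)
    (F : Eucl n → ℝ → Eucl n → Mat n → ℝ) (hF1 : CondF1 F) (hF2B : CondF2B lam Lam φ F)
    (Ω : Set (Eucl n)) (hΩo : IsOpen Ω) (hΩc : IsConnected Ω)
    (v : Eucl n → ℝ) (hlsc : LowerSemicontinuousOn v Ω)
    (hsuper : ViscositySupersolution F Ω v)
    (x₀ : Eucl n) (hx₀ : x₀ ∈ Ω) (hneg : v x₀ < 0) (hmin : ∀ x ∈ Ω, v x₀ ≤ v x) :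
    ∀ x ∈ Ω, v x = v x₀ := by
  have hopen : IsOpen {x | x ∈ Ω ∧ v x = v x₀} := by
    refine Metric.isOpen_iff.2 fun z ⟨hzΩ, hvz⟩ => ?_
    obtain ⟨ε, hε, hεΩ⟩ := Metric.isOpen_iff.1 hΩo z hzΩ
    have hsub : closedBall z (4 * (ε / 8)) ⊆ Ω :=
      (closedBall_subset_ball (by linarith)).trans hεΩ
    exact ⟨ε / 8, by positivity, fun y hy =>
      ⟨hεΩ (ball_subset_ball (by linarith) hy),
        hsuper.eq_min_of_mem_ball hlam hlamLam hφ hOsg hF1 hF2B hlsc hneg hmin hsub hvz hy⟩⟩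
  have hopen' : IsOpen (Ω ∩ v ⁻¹' Ioi (v x₀)) := by
    obtain ⟨u, hu, hueq⟩ := lowerSemicontinuousOn_iff_preimage_Ioi.1 hlsc (v x₀)
    exact hueq ▸ hΩo.inter hu
  intro x hx
  by_contra hne
  obtain ⟨p, -, hp, hp'⟩ := hΩc.isPreconnected _ _ hopen hopen'
    (fun p hp => (hmin p hp).eq_or_lt.imp (fun h => ⟨hp, h.symm⟩) fun h => ⟨hp, h⟩)
    ⟨x₀, hx₀, hx₀, rfl⟩ ⟨x, hx, hx, lt_of_le_of_ne (hmin x hx) (Ne.symm hne)⟩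
  exact (mem_Ioi.1 hp'.2).ne' hp.2
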